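/- Let α ∈ (0,2). Let X_1, X_2, … be independent identically distributed real random variables whose common distribution is symmetric about 0 and has a probability density function f satisfying f(u) ≍ u^{-1-α} as u → ∞. For n ∈ ℕ let S_n := X_1 + … + X_n. Then for any sequences (n_k) of positive integers and (x_k) of positive reals, P(S_{n_k} > x_k) → 0 as k → ∞ if and only if n_k / x_k^α → 0 as k → ∞. -/

import Mathlib

open MeasureTheory ProbabilityTheory Filter

lemma law_lower (α : ℝ) (hα : 0 < α) (μ : Measure ℝ) [IsProbabilityMeasure μ] (f : ℝ → ℝ)
    (hpdf : μ = (volume : Measure ℝ).withDensity (fun u => ENNReal.ofReal (f u)))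
    (k0 u0 : ℝ) (hk0 : 0 < k0) (hu0 : 0 < u0)
    (htail : ∀ u, u0 ≤ u → k0 * u ^ (-1 - α) ≤ f u) (x : ℝ) :
    k0 * 2 ^ (-1 - α) * (max x u0) ^ (-α) ≤ μ.real (Set.Ioi x) := by
  set m := max x u0 with hm
  have hm0 : 0 < m := lt_of_lt_of_le hu0 (le_max_right _ _)
  have h1 : ENNReal.ofReal (k0 * (2 * m) ^ (-1 - α)) * ENNReal.ofReal m ≤ μ (Set.Ioc m (2 * m)) := by
    rw [hpdf, withDensity_apply _ measurableSet_Ioc]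
    calc _ = ∫⁻ u in Set.Ioc m (2 * m), ENNReal.ofReal (k0 * (2 * m) ^ (-1 - α)) := by
          rw [setLIntegral_const, Real.volume_Ioc]; congr 2; ring
      _ ≤ _ := by
          refine setLIntegral_mono' measurableSet_Ioc fun u hu => ENNReal.ofReal_le_ofReal ?_
          refine le_trans ?_ (htail u ((le_max_right _ _).trans hu.1.le))
          refine mul_le_mul_of_nonneg_left ?_ hk0.le
          exact Real.rpow_le_rpow_of_nonpos (hm0.trans hu.1) hu.2 (by linarith)
  have h2 : μ (Set.Ioc m (2 * m)) ≤ μ (Set.Ioi x) :=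
    measure_mono fun u hu => lt_of_le_of_lt (le_max_left _ _) hu.1
  have h3 := h1.trans h2
  rw [← ENNReal.ofReal_mul (by positivity), ENNReal.ofReal_le_iff_le_toReal (measure_ne_top _ _)] at h3
  refine le_trans (le_of_eq ?_) h3
  rw [Real.mul_rpow (by norm_num) hm0.le]
  have : m ^ (-α) = m ^ (-1 - α) * m := by
    rw [← Real.rpow_add_one hm0.ne']; congr 1; ring
  rw [this]; ring

lemma law_upper (α : ℝ) (hα : 0 < α) (μ : Measure ℝ) [IsProbabilityMeasure μ] (f : ℝ → ℝ)
    (hpdf : μ = (volume : Measure ℝ).withDensity (fun u => ENNReal.ofReal (f u)))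
    (K0 u0 : ℝ) (hK0 : 0 < K0) (hu0 : 0 < u0)
    (htail : ∀ u, u0 ≤ u → f u ≤ K0 * u ^ (-1 - α)) (x : ℝ) (hx : u0 ≤ x) :
    μ.real (Set.Ioi x) ≤ K0 / α * x ^ (-α) := by
  have hx0 : 0 < x := hu0.trans_le hx
  have hi : IntegrableOn (fun u : ℝ => K0 * u ^ (-1 - α)) (Set.Ioi x) :=
    (integrableOn_Ioi_rpow_of_lt (by linarith) hx0).const_mul _
  have h1 : μ (Set.Ioi x) ≤ ENNReal.ofReal (K0 / α * x ^ (-α)) := by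
    rw [hpdf, withDensity_apply _ measurableSet_Ioi]
    calc _ ≤ ∫⁻ u in Set.Ioi x, ENNReal.ofReal (K0 * u ^ (-1 - α)) :=
          setLIntegral_mono' measurableSet_Ioi fun u hu =>
            ENNReal.ofReal_le_ofReal (htail u (hx.trans (le_of_lt hu)))
      _ = _ := by
          rw [← ofReal_integral_eq_lintegral_ofReal hi, integral_const_mul,
            integral_Ioi_rpow_of_lt (by linarith) hx0]
          · congr 1
            have : -1 - α + 1 = -α := by ring
            rw [this]; field_simp
          · filter_upwards [ae_restrict_mem measurableSet_Ioi] with u hu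
            have : 0 < u := hx0.trans hu
            simp only [Pi.zero_apply]; positivity
  exact ENNReal.toReal_le_of_le_ofReal (by positivity) h1

/-- truncation at level x -/
noncomputable def trunc (x t : ℝ) : ℝ := if |t| ≤ x then t else 0

lemma trunc_meas (x : ℝ) : Measurable (trunc x) :=
  Measurable.ite (measurableSet_le (by fun_prop) measurable_const) measurable_id measurable_const

lemma trunc_neg (x t : ℝ) : trunc x (-t) = - trunc x t := by
  unfold trunc; rw [abs_neg]; split_ifs <;> simp

lemma trunc_abs (x : ℝ) (hx : 0 ≤ x) (t : ℝ) : |trunc x t| ≤ x := by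
  unfold trunc; split_ifs with h <;> simp [*]

lemma law_trunc (α : ℝ) (hα : α < 2) (μ : Measure ℝ) [IsProbabilityMeasure μ] (f : ℝ → ℝ)
    (hfm : Measurable f) (hsymm : μ.map (fun t => -t) = μ)
    (hpdf : μ = (volume : Measure ℝ).withDensity (fun u => ENNReal.ofReal (f u)))
    (K0 u0 : ℝ) (hK0 : 0 < K0) (hu0 : 0 < u0)
    (htail : ∀ u, u0 ≤ u → f u ≤ K0 * u ^ (-1 - α)) (x : ℝ) (hx : u0 ≤ x) :
    ∫ t, (trunc x t) ^ 2 ∂μ ≤ (u0 ^ α + 2 * (K0 / (2 - α))) * x ^ (2 - α) := by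
  have hx0 : 0 < x := hu0.trans_le hx
  set h : ℝ → ENNReal := (Set.Ioc u0 x).indicator (fun t => ENNReal.ofReal (t ^ 2)) with hh
  have hhm : Measurable h := Measurable.indicator (by fun_prop) measurableSet_Ioc
  have hneg : ∫⁻ t, h (-t) ∂μ = ∫⁻ t, h t ∂μ := by
    conv_rhs => rw [← hsymm]
    rw [lintegral_map hhm measurable_neg]
  have hint : IntegrableOn (fun u : ℝ => K0 * u ^ (1 - α)) (Set.Ioc u0 x) := by
    have := (intervalIntegral.intervalIntegrable_rpow' (a := u0) (b := x) (r := 1 - α) (by linarith))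
    rw [intervalIntegrable_iff_integrableOn_Ioc_of_le hx] at this
    exact this.const_mul _
  have hb : ∫⁻ t, h t ∂μ ≤ ENNReal.ofReal (K0 / (2 - α) * x ^ (2 - α)) := by
    rw [lintegral_indicator measurableSet_Ioc, hpdf,
      setLIntegral_withDensity_eq_setLIntegral_mul _ (by fun_prop) (by fun_prop) measurableSet_Ioc]
    calc _ ≤ ∫⁻ u in Set.Ioc u0 x, ENNReal.ofReal (K0 * u ^ (1 - α)) := by
          refine setLIntegral_mono' measurableSet_Ioc fun u hu => ?_
          have hu' : 0 < u := hu0.trans hu.1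
          simp only [Pi.mul_apply]
          rw [← ENNReal.ofReal_mul' (by positivity)]
          refine ENNReal.ofReal_le_ofReal ?_
          have e : u ^ (1 - α) = u ^ (-1 - α) * u ^ 2 := by
            rw [← Real.rpow_natCast u 2, ← Real.rpow_add hu']; congr 1; push_cast; ring
          rw [e, ← mul_assoc]
          exact mul_le_mul_of_nonneg_right (htail u hu.1.le) (by positivity)
      _ ≤ _ := by
          rw [← ofReal_integral_eq_lintegral_ofReal hint]
          · refine ENNReal.ofReal_le_ofReal ?_
            rw [integral_const_mul, ← intervalIntegral.integral_of_le hx,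
              integral_rpow (Or.inl (by linarith))]
            have : 1 - α + 1 = 2 - α := by ring
            rw [this, div_mul_eq_mul_div, ← mul_div_assoc]
            have h2 : 0 < 2 - α := by linarith
            have := Real.rpow_nonneg hu0.le (2 - α)
            gcongr
            linarith
          · filter_upwards [ae_restrict_mem measurableSet_Ioc] with u hu
            have : 0 < u := hu0.trans hu.1
            simp only [Pi.zero_apply]; positivity
  have hmain : ∫⁻ t, ENNReal.ofReal ((trunc x t) ^ 2) ∂μ ≤
      ENNReal.ofReal ((u0 ^ α + 2 * (K0 / (2 - α))) * x ^ (2 - α)) := by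
    calc _ ≤ ∫⁻ t, (ENNReal.ofReal (u0 ^ 2) + (h t + h (-t))) ∂μ := by
          refine lintegral_mono fun t => ?_
          by_cases h1 : |t| ≤ x
          · simp only [trunc, h1, if_true]
            by_cases h2 : |t| ≤ u0
            · refine le_trans (ENNReal.ofReal_le_ofReal ?_) le_self_add
              exact sq_le_sq' (by linarith [(abs_le.1 h2).1]) (abs_le.1 h2).2
            · push Not at h2
              have ⟨ha, hb⟩ := abs_le.1 h1
              rcases lt_abs.1 h2 with h3 | h3
              · have : h t = ENNReal.ofReal (t ^ 2) := Set.indicator_of_mem (s := Set.Ioc u0 x) ⟨h3, hb⟩ _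
                rw [← this]
                exact le_trans le_self_add le_add_self
              · have : h (-t) = ENNReal.ofReal ((-t) ^ 2) :=
                  Set.indicator_of_mem (s := Set.Ioc u0 x) ⟨h3, by linarith⟩ _
                rw [neg_sq] at this
                rw [← this]
                exact le_trans le_add_self le_add_self
          · simp [trunc, h1]
      _ = ENNReal.ofReal (u0 ^ 2) + (∫⁻ t, h t ∂μ + ∫⁻ t, h t ∂μ) := by
          rw [lintegral_add_left measurable_const, lintegral_add_left hhm, hneg]; simp
      _ ≤ ENNReal.ofReal (u0 ^ 2) + (ENNReal.ofReal (K0 / (2 - α) * x ^ (2 - α)) + ENNReal.ofReal (K0 / (2 - α) * x ^ (2 - α))) := by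
          gcongr
      _ ≤ _ := by
          have h2 : 0 < 2 - α := by linarith
          rw [← ENNReal.ofReal_add (by positivity) (by positivity), ← ENNReal.ofReal_add (by positivity) (by positivity)]
          refine ENNReal.ofReal_le_ofReal ?_
          have e : u0 ^ 2 ≤ u0 ^ α * x ^ (2 - α) := by
            calc u0 ^ 2 = u0 ^ α * u0 ^ (2 - α) := by
                  rw [← Real.rpow_natCast u0 2, ← Real.rpow_add hu0]; congr 1; push_cast; ring
              _ ≤ _ := by gcongr
          linarith
  rw [integral_eq_lintegral_of_nonneg_ae (ae_of_all _ fun t => sq_nonneg _)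
    ((trunc_meas x).pow_const 2).aestronglyMeasurable]
  have h2 : 0 < 2 - α := by linarith
  exact ENNReal.toReal_le_of_le_ofReal (by positivity) hmain

lemma sum_nonneg_prob {Ω : Type*} [MeasurableSpace Ω] {P : Measure Ω} [IsProbabilityMeasure P]
    (X : ℕ → Ω → ℝ) (hindep : iIndepFun X P)
    (hs : ∀ i, IdentDistrib (X i) (fun ω => - X i ω) P P) (s : Finset ℕ) :
    1 / 2 ≤ P.real {ω | 0 ≤ (∑ i ∈ s, X i) ω} := by
  have h1 := IdentDistrib.pi hs hindep (hindep.comp (fun _ t => -t) (fun _ => measurable_neg))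
  have h2 := h1.comp (u := fun y : ℕ → ℝ => ∑ i ∈ s, y i) (by fun_prop)
  have h3 := h2.measure_mem_eq (s := Set.Ici 0) measurableSet_Ici
  have h4 : P.real {ω | 0 ≤ (∑ i ∈ s, X i) ω} = P.real {ω | (∑ i ∈ s, X i) ω ≤ 0} := by
    unfold Measure.real
    congr 1
    convert h3 using 2
    · ext ω; simp
    · ext ω; simp
  have h5 : (1 : ℝ) ≤ P.real {ω | 0 ≤ (∑ i ∈ s, X i) ω} + P.real {ω | (∑ i ∈ s, X i) ω ≤ 0} := by
    refine le_trans (le_of_eq ?_) (measureReal_union_le _ _)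
    rw [← probReal_univ (μ := P)]
    congr 1
    ext ω; simpa using le_total _ _
  linarith

lemma prob_lower {Ω : Type*} [MeasurableSpace Ω] {P : Measure Ω} [IsProbabilityMeasure P]
    (X : ℕ → Ω → ℝ) (hmeas : ∀ i, Measurable (X i)) (hindep : iIndepFun X P)
    (hs : ∀ i, IdentDistrib (X i) (fun ω => - X i ω) P P) (x p : ℝ) (hp0 : 0 < p)
    (hp : ∀ i, P.real {ω | x < X i ω} = p) (n : ℕ) :
    min (n * p) (1 / 2) / 4 ≤ P.real {ω | (∑ i ∈ Finset.range n, X i ω) > x} := by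
  set A : ℕ → Set Ω := fun i => {ω | x < X i ω} ∩ {ω | 0 ≤ (∑ j ∈ (Finset.range n).erase i, X j) ω}
    with hA
  have hAm : ∀ i, MeasurableSet (A i) := fun i =>
    (measurableSet_lt measurable_const (hmeas i)).inter
      (measurableSet_le measurable_const (by fun_prop))
  have hAp : ∀ i, p / 2 ≤ P.real (A i) := by
    intro i
    have h1 := (hindep.indepFun_finsetSum_of_notMem hmeas
      (Finset.notMem_erase i (Finset.range n))).symm
    have h2 := h1.measure_inter_preimage_eq_mul (Set.Ioi x) (Set.Ici 0) measurableSet_Ioi measurableSet_Ici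
    have h3 : P.real (A i) = P.real {ω | x < X i ω} *
        P.real {ω | 0 ≤ (∑ j ∈ (Finset.range n).erase i, X j) ω} := by
      unfold Measure.real
      rw [← ENNReal.toReal_mul]
      exact congrArg _ h2
    rw [h3, hp]
    have := sum_nonneg_prob X hindep hs ((Finset.range n).erase i)
    nlinarith
  have hAA : ∀ i j, i ≠ j → P.real (A i ∩ A j) ≤ p ^ 2 := by
    intro i j hij
    have h2 := (hindep.indepFun hij).measure_inter_preimage_eq_mul (Set.Ioi x) (Set.Ioi x)
      measurableSet_Ioi measurableSet_Ioi
    have h3 : P.real ({ω | x < X i ω} ∩ {ω | x < X j ω}) = p ^ 2 := by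
      rw [sq]; nth_rw 1 [← hp i]; rw [← hp j]
      unfold Measure.real
      rw [← ENNReal.toReal_mul]
      exact congrArg _ h2
    rw [← h3]
    exact measureReal_mono (Set.inter_subset_inter Set.inter_subset_left Set.inter_subset_left)
  have hU : ∀ k : ℕ, (k * p / 2) * (1 - (k - 1) * p) ≤ P.real (⋃ i ∈ Finset.range k, A i) := by
    intro k
    induction k with
    | zero => simp
    | succ k ih =>
      have h1 : (⋃ i ∈ Finset.range (k + 1), A i) = (⋃ i ∈ Finset.range k, A i) ∪ A k := by
        rw [Finset.range_add_one, Finset.set_biUnion_insert, Set.union_comm]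
      have h2 := measureReal_union_add_inter (μ := P) (s := ⋃ i ∈ Finset.range k, A i) (hAm k)
        (measure_ne_top _ _) (measure_ne_top _ _)
      have h3 : P.real ((⋃ i ∈ Finset.range k, A i) ∩ A k) ≤ k * p ^ 2 := by
        rw [Set.iUnion₂_inter]
        refine (measureReal_biUnion_finset_le _ _).trans ?_
        refine (Finset.sum_le_card_nsmul _ _ (p ^ 2) ?_).trans (by simp)
        intro i hi
        exact hAA i k (Finset.mem_range.1 hi).ne
      rw [h1]
      have := hAp k
      push_cast
      nlinarith
  have hsub : ∀ k ≤ n, P.real (⋃ i ∈ Finset.range k, A i) ≤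
      P.real {ω | (∑ i ∈ Finset.range n, X i ω) > x} := by
    intro k hk
    refine measureReal_mono ?_
    refine Set.iUnion₂_subset fun i hi ω hω => ?_
    have hi' : i ∈ Finset.range n := Finset.mem_range.2 ((Finset.mem_range.1 hi).trans_le hk)
    have h1 : x < X i ω := hω.1
    have h2 : 0 ≤ (∑ j ∈ (Finset.range n).erase i, X j) ω := hω.2
    rw [Finset.sum_apply] at h2
    have := Finset.add_sum_erase (Finset.range n) (fun j => X j ω) hi'
    simp only [Set.mem_ofPred_eq, gt_iff_lt]
    linarith
  by_cases hc : n * p ≤ 1 / 2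
  · refine le_trans ?_ ((hU n).trans (hsub n le_rfl))
    rw [min_eq_left hc]
    have : 0 ≤ n * p := by positivity
    nlinarith
  · push Not at hc
    rw [min_eq_right hc.le]
    set k := ⌈1 / (2 * p)⌉₊ with hk
    have hk1 : 1 / (2 * p) ≤ k := Nat.le_ceil _
    have hk2 : (k : ℝ) < 1 / (2 * p) + 1 := Nat.ceil_lt_add_one (by positivity)
    have hkn : k ≤ n := Nat.ceil_le.2 (by rw [div_le_iff₀ (by positivity)]; linarith)
    refine le_trans ?_ ((hU k).trans (hsub k hkn))
    have e : 1 / (2 * p) * p = 1 / 2 := by field_simp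
    have a1 : 1 / 2 ≤ k * p := by nlinarith
    have a2 : ((k : ℝ) - 1) * p ≤ 1 / 2 := by nlinarith
    nlinarith

lemma prob_upper {Ω : Type*} [MeasurableSpace Ω] {P : Measure Ω} [IsProbabilityMeasure P]
    (X : ℕ → Ω → ℝ) (hmeas : ∀ i, Measurable (X i)) (hindep : iIndepFun X P)
    (hs : ∀ i, IdentDistrib (X i) (fun ω => - X i ω) P P) (x p v : ℝ) (hx : 0 < x)
    (hp : ∀ i, P.real {ω | x < |X i ω|} ≤ p)
    (hv : ∀ i, ∫ ω, (trunc x (X i ω)) ^ 2 ∂P ≤ v) (n : ℕ) :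
    P.real {ω | (∑ i ∈ Finset.range n, X i ω) > x} ≤ n * p + n * v / x ^ 2 := by
  set Y : ℕ → Ω → ℝ := fun i ω => trunc x (X i ω) with hY
  have hYm : ∀ i, Measurable (Y i) := fun i => (trunc_meas x).comp (hmeas i)
  have hYL : ∀ i, MemLp (Y i) 2 P := fun i =>
    MemLp.of_bound (hYm i).aestronglyMeasurable x (ae_of_all _ fun ω => trunc_abs x hx.le _)
  have hYi : iIndepFun Y P := hindep.comp (fun _ => trunc x) (fun _ => trunc_meas x)
  have hY0 : ∀ i, ∫ ω, Y i ω ∂P = 0 := by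
    intro i
    have h1 := ((hs i).comp (trunc_meas x)).integral_eq
    have h2 : ∫ ω, Y i ω ∂P = - ∫ ω, Y i ω ∂P := by
      rw [← integral_neg]
      refine h1.trans (integral_congr_ae (ae_of_all _ fun ω => ?_))
      exact trunc_neg x _
    linarith
  have hS0 : ∫ ω, (∑ i ∈ Finset.range n, Y i) ω ∂P = 0 := by
    simp only [Finset.sum_apply]
    rw [integral_finsetSum _ fun i _ => (hYL i).integrable (by norm_num)]
    simp [hY0]
  have hvar : variance (∑ i ∈ Finset.range n, Y i) P ≤ n * v := by
    rw [IndepFun.variance_sum (fun i _ => hYL i) (fun i _ j _ hij => hYi.indepFun hij)]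
    refine (Finset.sum_le_card_nsmul _ _ v ?_).trans (by simp)
    intro i _
    exact (variance_le_expectation_sq (hYm i).aestronglyMeasurable).trans (hv i)
  have hcheb := meas_ge_le_variance_div_sq (memLp_finsetSum' (Finset.range n) fun i _ => hYL i) hx
  rw [hS0] at hcheb
  have hcheb2 : P.real {ω | x ≤ |(∑ i ∈ Finset.range n, Y i) ω - 0|} ≤ n * v / x ^ 2 :=
    (ENNReal.toReal_le_of_le_ofReal (div_nonneg (variance_nonneg _ _) (by positivity)) hcheb).trans
      (by gcongr)
  have hun : P.real (⋃ i ∈ Finset.range n, {ω | x < |X i ω|}) ≤ n * p :=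
    (measureReal_biUnion_finset_le _ _).trans
      ((Finset.sum_le_card_nsmul _ _ p fun i _ => hp i).trans (by simp))
  refine le_trans (le_trans (measureReal_mono ?_) (measureReal_union_le _ _)) (add_le_add hun hcheb2)
  intro ω hω
  by_cases h : ∃ i ∈ Finset.range n, x < |X i ω|
  · left
    obtain ⟨i, hi, h⟩ := h
    exact Set.mem_biUnion hi h
  · right
    push Not at h
    have : (∑ i ∈ Finset.range n, Y i) ω = ∑ i ∈ Finset.range n, X i ω := by
      rw [Finset.sum_apply]
      refine Finset.sum_congr rfl fun i hi => ?_
      simp only [hY, trunc, h i hi, if_true]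
    change x ≤ |(∑ i ∈ Finset.range n, Y i) ω - 0|
    rw [this, sub_zero]
    exact (le_of_lt hω).trans (le_abs_self _)

theorem large_deviation_iff
    {Ω : Type*} [MeasureSpace Ω] [IsProbabilityMeasure (ℙ : Measure Ω)]
    (α : ℝ) (hα : α ∈ Set.Ioo (0 : ℝ) 2)
    (X : ℕ → Ω → ℝ) (hmeas : ∀ i, Measurable (X i))
    (hindep : iIndepFun X ℙ)
    (hident : ∀ i, IdentDistrib (X i) (X 0) ℙ ℙ)
    (hsymm : Measure.map (X 0) ℙ = Measure.map (fun ω => -(X 0 ω)) ℙ)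
    (f : ℝ → ℝ) (hf0 : ∀ u, 0 ≤ f u) (hfmeas : Measurable f)
    (hpdf : Measure.map (X 0) ℙ = (volume : Measure ℝ).withDensity (fun u => ENNReal.ofReal (f u)))
    (k0 K0 u0 : ℝ) (hk0 : 0 < k0) (hK0 : k0 ≤ K0) (hu0 : 0 < u0)
    (htail : ∀ u, u0 ≤ u → k0 * u ^ (-1 - α) ≤ f u ∧ f u ≤ K0 * u ^ (-1 - α))
    (n : ℕ → ℕ) (hn : ∀ k, 0 < n k)
    (x : ℕ → ℝ) (hx : ∀ k, 0 < x k)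
:
    Tendsto (fun k => (ℙ {ω | (∑ i ∈ Finset.range (n k), X i ω) > x k}).toReal) atTop (nhds 0) ↔
      Tendsto (fun k => (n k : ℝ) / x k ^ α) atTop (nhds 0) := by
  obtain ⟨hα0, hα2⟩ := hα
  have hK0' : 0 < K0 := hk0.trans_le hK0
  set μ : Measure ℝ := Measure.map (X 0) ℙ with hμ
  have hprob : IsProbabilityMeasure μ := Measure.isProbabilityMeasure_map (hmeas 0).aemeasurable
  have hs0 : IdentDistrib (X 0) (fun ω => - X 0 ω) ℙ ℙ :=
    ⟨(hmeas 0).aemeasurable, (hmeas 0).neg.aemeasurable, hsymm⟩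
  have hs : ∀ i, IdentDistrib (X i) (fun ω => - X i ω) ℙ ℙ := fun i =>
    ((hident i).trans hs0).trans ((hident i).symm.comp measurable_neg)
  have hμs : μ.map (fun t => -t) = μ := by
    conv_rhs => rw [hsymm]
    rw [hμ, Measure.map_map measurable_neg (hmeas 0)]
    rfl
  have hp : ∀ y i, (ℙ : Measure Ω).real {ω | y < X i ω} = μ.real (Set.Ioi y) := by
    intro y i
    have h1 := (hident i).measure_mem_eq (s := Set.Ioi y) measurableSet_Ioi
    rw [← Measure.map_apply (hmeas 0) measurableSet_Ioi] at h1
    exact congrArg ENNReal.toReal h1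
  have hlow := law_lower α hα0 μ f hpdf k0 u0 hk0 hu0 (fun u hu => (htail u hu).1)
  have hup := law_upper α hα0 μ f hpdf K0 u0 hK0' hu0 (fun u hu => (htail u hu).2)
  have htr := law_trunc α hα2 μ f hfmeas hμs hpdf K0 u0 hK0' hu0 (fun u hu => (htail u hu).2)
  set c : ℝ := k0 * 2 ^ (-1 - α) with hc
  have hc0 : 0 < c := by positivity
  constructor
  · intro h
    have hkey : ∀ k, min (n k * (c * (max (x k) u0) ^ (-α))) (1 / 2) / 4 ≤
        (ℙ {ω | (∑ i ∈ Finset.range (n k), X i ω) > x k}).toReal := by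
      intro k
      have hm0 : 0 < max (x k) u0 := lt_of_lt_of_le hu0 (le_max_right _ _)
      refine le_trans ?_ (prob_lower X hmeas hindep hs (x k) (μ.real (Set.Ioi (x k)))
        (lt_of_lt_of_le (by positivity) (hlow (x k))) (hp (x k)) (n k))
      gcongr
      exact hlow (x k)
    set δ : ℝ := min (c * u0 ^ (-α)) (1 / 2) / 4 with hδ
    have hδ0 : 0 < δ := by positivity
    have hev := h.eventually (gt_mem_nhds hδ0)
    have hlim := h.const_mul (4 / c)
    rw [mul_zero] at hlim
    refine tendsto_of_tendsto_of_tendsto_of_le_of_le' tendsto_const_nhds hlim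
      (Eventually.of_forall fun k => div_nonneg (Nat.cast_nonneg _) (Real.rpow_nonneg (hx k).le _)) ?_
    filter_upwards [hev] with k hk
    have h1 : (1 : ℝ) ≤ n k := by exact_mod_cast hn k
    have hxu : u0 ≤ x k := by
      by_contra hcon
      push Not at hcon
      have h2 := hkey k
      rw [max_eq_right hcon.le] at h2
      have h3 : δ ≤ min (n k * (c * u0 ^ (-α))) (1 / 2) / 4 := by
        rw [hδ]
        have h0 : 0 ≤ c * u0 ^ (-α) := by positivity
        have h4 : c * u0 ^ (-α) ≤ n k * (c * u0 ^ (-α)) := le_mul_of_one_le_left h0 h1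
        have := min_le_min_right (1 / 2) h4
        linarith
      linarith
    have h2 := hkey k
    rw [max_eq_left hxu] at h2
    have hδ8 : δ ≤ 1 / 2 / 4 := by
      rw [hδ]; gcongr; exact min_le_right _ _
    have h4 : min (n k * (c * (x k) ^ (-α))) (1 / 2) = n k * (c * (x k) ^ (-α)) := by
      rcases min_choice (n k * (c * (x k) ^ (-α))) (1 / 2 : ℝ) with h5 | h5
      · exact h5
      · rw [h5] at h2; linarith
    rw [h4, Real.rpow_neg (hx k).le] at h2
    rw [div_mul_eq_mul_div, le_div_iff₀ hc0]
    have : (n k : ℝ) / x k ^ α * c = n k * (c * (x k ^ α)⁻¹) := by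
      rw [div_eq_mul_inv]; ring
    rw [this]
    linarith
  · intro h
    set C : ℝ := 2 * (K0 / α) + (u0 ^ α + 2 * (K0 / (2 - α))) with hC
    have hev := h.eventually (gt_mem_nhds (show (0 : ℝ) < 1 / u0 ^ α by positivity))
    have hlim := h.const_mul C
    rw [mul_zero] at hlim
    refine tendsto_of_tendsto_of_tendsto_of_le_of_le' tendsto_const_nhds hlim
      (Eventually.of_forall fun k => ENNReal.toReal_nonneg) ?_
    filter_upwards [hev] with k hk
    have h1 : (1 : ℝ) ≤ n k := by exact_mod_cast hn k
    have hxk := hx k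
    have hxu : u0 ≤ x k := by
      by_contra hcon
      push Not at hcon
      have h2 : x k ^ α ≤ u0 ^ α := Real.rpow_le_rpow (hx k).le hcon.le hα0.le
      have h3 : 1 / u0 ^ α ≤ (n k : ℝ) / x k ^ α := by gcongr
      linarith
    have hpa : ∀ i, (ℙ : Measure Ω).real {ω | x k < |X i ω|} ≤ 2 * (K0 / α * x k ^ (-α)) := by
      intro i
      have h2 : (ℙ : Measure Ω).real {ω | x k < - X i ω} = μ.real (Set.Ioi (x k)) := by
        rw [← hp (x k) i]
        exact congrArg ENNReal.toReal ((hs i).measure_mem_eq (s := Set.Ioi (x k)) measurableSet_Ioi).symm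
      have h3 : {ω | x k < |X i ω|} = {ω | x k < X i ω} ∪ {ω | x k < - X i ω} := by
        ext ω; simp [lt_abs]
      rw [h3]
      refine (measureReal_union_le _ _).trans ?_
      rw [hp, h2]
      linarith [hup (x k) hxu]
    have hva : ∀ i, ∫ ω, (trunc (x k) (X i ω)) ^ 2 ∂(ℙ : Measure Ω) ≤
        (u0 ^ α + 2 * (K0 / (2 - α))) * x k ^ (2 - α) := by
      intro i
      refine le_trans (le_of_eq ?_) (htr (x k) hxu)
      have hm : Measurable fun t => (trunc (x k) t) ^ 2 := (trunc_meas _).pow_const 2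
      rw [hμ, integral_map (hmeas 0).aemeasurable hm.aestronglyMeasurable]
      exact ((hident i).comp hm).integral_eq
    refine (prob_upper X hmeas hindep hs (x k) _ _ (hx k) hpa hva (n k)).trans (le_of_eq ?_)
    have e1 : x k ^ (2 - α) = x k ^ 2 * (x k ^ α)⁻¹ := by
      rw [Real.rpow_sub (hx k), ← Real.rpow_natCast (x k) 2, div_eq_mul_inv]; norm_cast
    have h0 : 0 < x k ^ α := Real.rpow_pos_of_pos (hx k) _
    rw [e1, Real.rpow_neg (hx k).le, hC]
    field_simp
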